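/- arXiv:2401.14224 — 3 statements merged into one kernel-verified Lean document; each statement's English description precedes it below -/
import Mathlib

section
/- Let (X, 𝒜, μ) be a measure space with μ σ-finite, let H : ℝ × X → ℝ be such that for each λ the function x ↦ exp(−H(λ,x)) is μ-integrable with Z(λ) := ∫ exp(−H(λ,x)) dμ(x) > 0, and let ℓ : X → [0,∞) be measurable with Zℓ(λ) := ∫ ℓ(x) exp(−H(λ,x)) dμ(x) finite and strictly positive for each λ. Let Hₚ : ℝ → ℝ be differentiable at λ₀. Suppose there is a neighborhood U of λ₀ on which, for μ-almost every x, λ ↦ H(λ,x) is differentiable with derivative ∂λH(λ,x), and there are μ-integrable functions g₁, g₂ with |∂λH(λ,x)| exp(−H(λ,x)) ≤ g₁(x) and ℓ(x)|∂λH(λ,x)| exp(−H(λ,x)) ≤ g₂(x) for all λ ∈ U and μ-almost every x. Define the parameter posterior potential Hd(λ) := −log Zℓ(λ) + log Z(λ) + Hₚ(λ). Then Hd is differentiable at λ₀ and Hd'(λ₀) = E_post[∂λH(λ₀,·)] − E_prior[∂λH(λ₀,·)] + Hₚ'(λ₀), where E_prior denotes expectation under the probability measure exp(−H(λ₀,·))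 dμ / Z(λ₀) and E_post denotes expectation under ℓ exp(−H(λ₀,·)) dμ / Zℓ(λ₀). -/
open MeasureTheory

/-- If `F l` is almost everywhere strongly measurable for every `l` and `F · x` has derivative
`f' x` at `l₀` for almost every `x`, then `f'` is almost everywhere strongly measurable. -/
theorem aestronglyMeasurable_of_ae_hasDerivAt {X : Type*} [MeasurableSpace X] {μ : Measure X}
    {F : ℝ → X → ℝ} {f' : X → ℝ} {l₀ : ℝ} (hF : ∀ l, AEStronglyMeasurable (F l) μ)
    (hderiv : ∀ᵐ x ∂μ, HasDerivAt (fun t => F t x) (f' x) l₀) :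
    AEStronglyMeasurable f' μ := by
  refine aestronglyMeasurable_of_tendsto_ae (nhdsWithin l₀ {l₀}ᶜ)
    (f := fun l x => slope (fun t => F t x) l₀ l) (fun l => ?_) ?_
  · simp only [slope_def_field, div_eq_mul_inv]
    exact ((hF l).sub (hF l₀)).mul_const _
  · filter_upwards [hderiv] with x hx
    exact hasDerivAt_iff_tendsto_slope.mp hx

/-- Differentiation under the integral sign for a weighted Boltzmann factor. -/
theorem hasDerivAt_integral_mul_exp_neg {X : Type*} [MeasurableSpace X] {μ : Measure X}
    {H H' : ℝ → X → ℝ} {w g : X → ℝ} {l₀ : ℝ} {U : Set ℝ} (hw : ∀ x, 0 ≤ w x)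
    (hint : ∀ l, Integrable (fun x => w x * Real.exp (-H l x)) μ) (hU : U ∈ nhds l₀)
    (hderiv : ∀ᵐ x ∂μ, ∀ l ∈ U, HasDerivAt (fun t => H t x) (H' l x) l)
    (hg : Integrable g μ)
    (hdom : ∀ᵐ x ∂μ, ∀ l ∈ U, w x * (|H' l x| * Real.exp (-H l x)) ≤ g x) :
    HasDerivAt (fun l => ∫ x, w x * Real.exp (-H l x) ∂μ)
      (-∫ x, w x * (H' l₀ x * Real.exp (-H l₀ x)) ∂μ) l₀ := by
  have hF : ∀ᵐ x ∂μ, ∀ l ∈ U, HasDerivAt (fun t => w x * Real.exp (-H t x))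
      (-(w x * (H' l x * Real.exp (-H l x)))) l := by
    filter_upwards [hderiv] with x hx l hl
    exact ((hx l hl).neg.exp.const_mul (w x)).congr_deriv (by
      simp only [Pi.neg_apply]; ring)
  rw [← integral_neg]
  refine (hasDerivAt_integral_of_dominated_loc_of_deriv_le
    (F := fun l x => w x * Real.exp (-H l x))
    (F' := fun l x => -(w x * (H' l x * Real.exp (-H l x)))) hU
    (.of_forall fun l => (hint l).aestronglyMeasurable) (hint l₀) ?_ ?_ hg hF).2
  · exact aestronglyMeasurable_of_ae_hasDerivAt (fun l => (hint l).aestronglyMeasurable)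
      (hF.mono fun x hx => hx l₀ (mem_of_mem_nhds hU))
  · filter_upwards [hdom] with x hx l hl
    simpa [abs_mul, abs_of_nonneg (hw x)] using hx l hl

/-- Lemma 2 of the paper, single-parameter case: the derivative of the
parameter posterior potential `Hd l = -log (Zℓ l) + log (Z l) + Hp l` at `l₀` equals
the posterior expectation of `H' l₀` minus the prior expectation of `H' l₀` plus
`Hp' l₀`, where the prior is `exp (-H l₀ ·) dμ / Z l₀` and the posterior is
`ℓ · exp (-H l₀ ·) dμ / Zℓ l₀`. -/
theorem stmt_2 {X : Type*} [MeasurableSpace X] (μ : Measure X) [SigmaFinite μ]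
    (H H' : ℝ → X → ℝ) (ℓ : X → ℝ) (hℓmeas : Measurable ℓ) (hℓnonneg : ∀ x, 0 ≤ ℓ x)
    (hint : ∀ l : ℝ, Integrable (fun x => Real.exp (-H l x)) μ)
    (hintℓ : ∀ l : ℝ, Integrable (fun x => ℓ x * Real.exp (-H l x)) μ)
    (Z Zℓ : ℝ → ℝ)
    (hZ : ∀ l, Z l = ∫ x, Real.exp (-H l x) ∂μ)
    (hZℓ : ∀ l, Zℓ l = ∫ x, ℓ x * Real.exp (-H l x) ∂μ)
    (hZpos : ∀ l, 0 < Z l) (hZℓpos : ∀ l, 0 < Zℓ l)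
    (Hp : ℝ → ℝ) (Hp' : ℝ) (l₀ : ℝ) (hHp : HasDerivAt Hp Hp' l₀)
    (U : Set ℝ) (hU : U ∈ nhds l₀)
    (hderiv : ∀ᵐ x ∂μ, ∀ l ∈ U, HasDerivAt (fun t => H t x) (H' l x) l)
    (g₁ g₂ : X → ℝ) (hg₁ : Integrable g₁ μ) (hg₂ : Integrable g₂ μ)
    (hdom₁ : ∀ᵐ x ∂μ, ∀ l ∈ U, |H' l x| * Real.exp (-H l x) ≤ g₁ x)
    (hdom₂ : ∀ᵐ x ∂μ, ∀ l ∈ U, ℓ x * (|H' l x| * Real.exp (-H l x)) ≤ g₂ x) :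
    HasDerivAt (fun l => -Real.log (Zℓ l) + Real.log (Z l) + Hp l)
      ((1 / Zℓ l₀) * (∫ x, ℓ x * (H' l₀ x * Real.exp (-H l₀ x)) ∂μ)
        - (1 / Z l₀) * (∫ x, H' l₀ x * Real.exp (-H l₀ x) ∂μ) + Hp') l₀ := by
  have hdZ : HasDerivAt Z (-∫ x, H' l₀ x * Real.exp (-H l₀ x) ∂μ) l₀ := by
    rw [funext hZ]
    simpa using hasDerivAt_integral_mul_exp_neg (w := fun _ => 1) (fun _ => zero_le_one)
      (by simpa using hint) hU hderiv hg₁ (by simpa using hdom₁)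
  have hdZℓ : HasDerivAt Zℓ (-∫ x, ℓ x * (H' l₀ x * Real.exp (-H l₀ x)) ∂μ) l₀ := by
    rw [funext hZℓ]
    exact hasDerivAt_integral_mul_exp_neg hℓnonneg hintℓ hU hderiv hg₂ hdom₂
  exact (((hdZℓ.log (hZℓpos l₀).ne').neg.add (hdZ.log (hZpos l₀).ne')).add hHp).congr_deriv
    (by ring)
end

section
/- Let n be a positive integer, let S be a positive definite real n×n matrix, and let T be a nonzero symmetric real n×n matrix. Let (m̃ₖ)ₖ be a bounded sequence in ℝⁿ and let (S̃ₖ)ₖ be a sequence of positive semidefinite real n×n matrices converging to the zero matrix. Then there exists N such that for all k ≥ N, ½ tr(T S T S) − m̃ₖᵀ T S̃ₖ T m̃ₖ − ½ tr(T S̃ₖ T S̃ₖ) > 0. -/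
open Matrix

open scoped MatrixOrder in
/-- For positive definite `S` and nonzero symmetric `T`, the trace of `T S T S` is the squared
Frobenius norm of a nonzero matrix. -/
theorem trace_mul_mul_mul_pos {ι : Type*} [Fintype ι] [DecidableEq ι] {S T : Matrix ι ι ℝ}
    (hS : S.PosDef) (hT : T.IsSymm) (hT0 : T ≠ 0) : 0 < (T * S * T * S).trace := by
  obtain ⟨B, rfl⟩ := CStarAlgebra.nonneg_iff_eq_star_mul_self.mp hS.posSemidef.nonneg
  rw [star_eq_conjTranspose] at hS ⊢
  have hB : IsUnit B := isUnit_of_mul_isUnit_right hS.isUnit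
  have htr : (T * (Bᴴ * B) * T * (Bᴴ * B)).trace = ((B * T * Bᴴ)ᴴ * (B * T * Bᴴ)).trace := by
    have hT' : Tᴴ = T := by rw [conjTranspose_eq_transpose_of_trivial, hT.eq]
    rw [conjTranspose_mul, conjTranspose_mul, conjTranspose_conjTranspose, hT']
    simpa only [Matrix.mul_assoc] using trace_mul_comm (T * Bᴴ * B * T * Bᴴ) B
  rw [htr]
  refine (posSemidef_conjTranspose_mul_self _).trace_nonneg.lt_of_ne' fun h ↦ hT0 ?_
  rw [trace_conjTranspose_mul_self_eq_zero_iff] at h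
  have hB' : IsUnit Bᴴ := hB.star
  exact hB.mul_right_eq_zero.mp (hB'.mul_left_eq_zero.mp h)

/-- The quadratic form of a matrix sequence tending to zero, evaluated along a bounded sequence of
vectors, tends to zero. -/
theorem tendsto_dotProduct_mulVec_zero {α ι : Type*} [Fintype ι] {l : Filter α}
    {A : α → Matrix ι ι ℝ} {v : α → ι → ℝ} (hA : Filter.Tendsto A l (nhds 0))
    (hv : ∃ C : ℝ, ∀ k, ‖v k‖ ≤ C) :
    Filter.Tendsto (fun k ↦ v k ⬝ᵥ A k *ᵥ v k) l (nhds 0) := by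
  obtain ⟨C, hC⟩ := hv
  have hbdd (i : ι) : Filter.IsBoundedUnder (· ≤ ·) l ((‖·‖) ∘ fun k ↦ v k i) :=
    Filter.isBoundedUnder_of ⟨C, fun k ↦ (norm_le_pi_norm (v k) i).trans (hC k)⟩
  have hA' (i j : ι) : Filter.Tendsto (fun k ↦ A k i j) l (nhds 0) :=
    ((continuous_id.matrix_elem i j).tendsto (0 : Matrix ι ι ℝ)).comp hA
  have hAv (i : ι) : Filter.Tendsto (fun k ↦ (A k *ᵥ v k) i) l (nhds 0) := by
    simpa [mulVec, dotProduct] using tendsto_finsetSum Finset.univ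
      fun j _ ↦ (hA' i j).zero_mul_isBoundedUnder_le (hbdd j)
  simpa [dotProduct] using tendsto_finsetSum Finset.univ
    fun i _ ↦ Filter.isBoundedUnder_le_mul_tendsto_zero (hbdd i) (hAv i)

/-- the paper's informative-data Proposition, finite dimensions, single
parameter: if `S` is positive definite, `T` is a nonzero symmetric matrix, `(mt k)` is
a bounded sequence of vectors, and `(St k)` is a sequence of positive semidefinite
matrices converging to `0`, then eventually
`½ tr(T S T S) - mtₖᵀ T Stₖ T mtₖ - ½ tr(T Stₖ T Stₖ) > 0`. -/
theorem stmt_8 (n : ℕ) (hn : 0 < n) (S : Matrix (Fin n) (Fin n) ℝ) (hS : S.PosDef)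
    (T : Matrix (Fin n) (Fin n) ℝ) (hT : T.IsSymm) (hT0 : T ≠ 0)
    (mt : ℕ → Fin n → ℝ) (hmt : ∃ C : ℝ, ∀ k, ‖mt k‖ ≤ C)
    (St : ℕ → Matrix (Fin n) (Fin n) ℝ) (hSt : ∀ k, (St k).PosSemidef)
    (hlim : Filter.Tendsto St Filter.atTop (nhds 0)) :
    ∃ N : ℕ, ∀ k ≥ N,
      0 < (1 / 2) * (T * S * T * S).trace
          - mt k ⬝ᵥ (T * St k * T).mulVec (mt k)
          - (1 / 2) * (T * St k * T * St k).trace := by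
  have hcont₁ : Continuous fun X : Matrix (Fin n) (Fin n) ℝ ↦ T * X * T := by fun_prop
  have hcont₂ : Continuous fun X : Matrix (Fin n) (Fin n) ℝ ↦ (T * X * T * X).trace := by fun_prop
  have hmean := tendsto_dotProduct_mulVec_zero
    (by simpa using (hcont₁.tendsto 0).comp hlim) hmt
  have htrace := (hcont₂.tendsto 0).comp hlim
  have hlim' := (hmean.const_sub ((1 / 2) * (T * S * T * S).trace)).sub
    (htrace.const_mul (1 / 2))
  refine Filter.eventually_atTop.mp (hlim'.eventually_const_lt ?_)
  simpa using trace_mul_mul_mul_pos hS hT hT0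
end

section
/- Let (X, 𝒜, μ) be a measure space with μ σ-finite, let F : X → ℝ be measurable, and let ℓ : X → [0,∞) be measurable. Assume that for every λ ∈ ℝ the functions exp(−λF), F·exp(−λF), F²·exp(−λF), ℓ·exp(−λF), ℓ·F·exp(−λF), and ℓ·F²·exp(−λF) are μ-integrable, and that Z(λ) := ∫ exp(−λF(x)) dμ(x) > 0 and Zℓ(λ) := ∫ ℓ(x) exp(−λF(x)) dμ(x) > 0 for every λ. Define Hd(λ) := log Z(λ) − log Zℓ(λ). Assume the data are informative: for every λ ∈ ℝ, Var_post,λ[F] < Var_prior,λ[F], where Var_prior,λ denotes variance under exp(−λF) dμ / Z(λ) and Var_post,λ denotes variance under ℓ exp(−λF) dμ / Zℓ(λ). If there exists λ* ∈ ℝ with E_post,λ*[F] = E_prior,λ*[F] (the expectations under the respective probability measures agree), then λ* is the unique global minimizer of Hd: Hd(λ*) < Hd(λ) for all λ ≠ λ*. -/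
open MeasureTheory

/-- The prior partition function `Z(λ) = ∫ exp(-λ F x) dμ(x)`. -/
noncomputable def priorZ {X : Type*} [MeasurableSpace X] (μ : Measure X)
    (F : X → ℝ) (l : ℝ) : ℝ :=
  ∫ x, Real.exp (-(l * F x)) ∂μ

/-- The posterior partition function `Zℓ(λ) = ∫ ℓ(x) exp(-λ F x) dμ(x)`. -/
noncomputable def postZ {X : Type*} [MeasurableSpace X] (μ : Measure X)
    (ℓ F : X → ℝ) (l : ℝ) : ℝ :=
  ∫ x, ℓ x * Real.exp (-(l * F x)) ∂μ

/-- Expectation of `F` under the prior `exp(-λF) dμ / Z(λ)`. -/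
noncomputable def priorMean {X : Type*} [MeasurableSpace X] (μ : Measure X)
    (F : X → ℝ) (l : ℝ) : ℝ :=
  (1 / priorZ μ F l) * ∫ x, F x * Real.exp (-(l * F x)) ∂μ

/-- Expectation of `F` under the posterior `ℓ exp(-λF) dμ / Zℓ(λ)`. -/
noncomputable def postMean {X : Type*} [MeasurableSpace X] (μ : Measure X)
    (ℓ F : X → ℝ) (l : ℝ) : ℝ :=
  (1 / postZ μ ℓ F l) * ∫ x, ℓ x * (F x * Real.exp (-(l * F x))) ∂μ

/-- Variance of `F` under the prior `exp(-λF) dμ / Z(λ)`. -/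
noncomputable def priorVar {X : Type*} [MeasurableSpace X] (μ : Measure X)
    (F : X → ℝ) (l : ℝ) : ℝ :=
  (1 / priorZ μ F l) * (∫ x, F x ^ 2 * Real.exp (-(l * F x)) ∂μ) - priorMean μ F l ^ 2

/-- Variance of `F` under the posterior `ℓ exp(-λF) dμ / Zℓ(λ)`. -/
noncomputable def postVar {X : Type*} [MeasurableSpace X] (μ : Measure X)
    (ℓ F : X → ℝ) (l : ℝ) : ℝ :=
  (1 / postZ μ ℓ F l) * (∫ x, ℓ x * (F x ^ 2 * Real.exp (-(l * F x))) ∂μ)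
    - postMean μ ℓ F l ^ 2

/-- Differentiation under the integral sign for the moments of an exponential family. -/
lemma hasDerivAt_integral_pow_mul_exp_neg {X : Type*} [MeasurableSpace X] {ν : Measure X}
    {F : X → ℝ} (hint : ∀ l : ℝ, Integrable (fun x => Real.exp (-(l * F x))) ν)
    (n : ℕ) (l : ℝ) :
    HasDerivAt (fun l : ℝ => ∫ x, F x ^ n * Real.exp (-(l * F x)) ∂ν)
      (-∫ x, F x ^ (n + 1) * Real.exp (-(l * F x)) ∂ν) l := by
  have huniv : ProbabilityTheory.integrableExpSet F ν = Set.univ := by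
    refine Set.eq_univ_of_forall fun t => ?_
    simpa [ProbabilityTheory.integrableExpSet] using hint (-t)
  have hmem : -l ∈ interior (ProbabilityTheory.integrableExpSet F ν) := by simp [huniv]
  have h := (ProbabilityTheory.hasDerivAt_integral_pow_mul_exp_real hmem n).comp l
    (hasDerivAt_neg l)
  simpa [Function.comp_def] using h

/-- Weighted version of `hasDerivAt_integral_pow_mul_exp_neg`. -/
lemma hasDerivAt_integral_mul_pow_mul_exp_neg {X : Type*} [MeasurableSpace X] {μ : Measure X}
    {w F : X → ℝ} (hw : Measurable w) (hw0 : ∀ x, 0 ≤ w x)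
    (hint : ∀ l : ℝ, Integrable (fun x => w x * Real.exp (-(l * F x))) μ)
    (n : ℕ) (l : ℝ) :
    HasDerivAt (fun l : ℝ => ∫ x, w x * (F x ^ n * Real.exp (-(l * F x))) ∂μ)
      (-∫ x, w x * (F x ^ (n + 1) * Real.exp (-(l * F x))) ∂μ) l := by
  have hmeas : Measurable fun x => ENNReal.ofReal (w x) := hw.ennreal_ofReal
  have hfin : ∀ᵐ x ∂μ, ENNReal.ofReal (w x) < ⊤ := .of_forall fun _ => ENNReal.ofReal_lt_top
  have hint' (l : ℝ) : Integrable (fun x => Real.exp (-(l * F x)))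
      (μ.withDensity fun x => ENNReal.ofReal (w x)) := by
    rw [integrable_withDensity_iff_integrable_smul' hmeas hfin]
    simpa [ENNReal.toReal_ofReal, hw0] using hint l
  simpa [integral_withDensity_eq_integral_toReal_smul hmeas hfin, ENNReal.toReal_ofReal, hw0]
    using hasDerivAt_integral_pow_mul_exp_neg hint' n l

/-- The quotient `M / Z` of the first two moment functions of an exponential family has minus the
variance as its derivative. -/
lemma hasDerivAt_one_div_mul {Z M : ℝ → ℝ} {S l : ℝ} (hZ : HasDerivAt Z (-M l) l)
    (hM : HasDerivAt M (-S) l) (h0 : Z l ≠ 0) :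
    HasDerivAt (fun l => 1 / Z l * M l) (-(1 / Z l * S - (1 / Z l * M l) ^ 2)) l := by
  refine ((hM.div hZ h0).congr_deriv ?_).congr_of_eventuallyEq (.of_forall fun l => ?_)
  · field_simp
    ring
  · simp [div_eq_inv_mul]

/-- A real function whose derivative is strictly increasing and vanishes at `a` has a strict
global minimum at `a`. -/
lemma lt_of_hasDerivAt_of_strictMono {H G : ℝ → ℝ} {a l : ℝ} (hH : ∀ x, HasDerivAt H (G x) x)
    (hG : StrictMono G) (ha : G a = 0) (hl : l ≠ a) : H a < H l := by
  have hcont : Continuous H := continuous_iff_continuousAt.2 fun x => (hH x).continuousAt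
  rcases hl.lt_or_gt with hl | hl
  · refine strictAntiOn_of_deriv_neg (convex_Iic a) hcont.continuousOn (fun x hx => ?_)
      hl.le Set.self_mem_Iic hl
    rw [interior_Iic] at hx
    rw [(hH x).deriv, ← ha]
    exact hG hx
  · refine strictMonoOn_of_deriv_pos (convex_Ici a) hcont.continuousOn (fun x hx => ?_)
      Set.self_mem_Ici hl.le hl
    rw [interior_Ici] at hx
    rw [(hH x).deriv, ← ha]
    exact hG hx

/-- the paper's main Theorem, linear single-parameter case with flat
parameter prior: if the data are informative, i.e. `Var_post,λ[F] < Var_prior,λ[F]`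
for every `λ`, and the gradient of the parameter posterior potential
`Hd(λ) = log Z(λ) - log Zℓ(λ)` has a root `λ*` (i.e. `E_post,λ*[F] = E_prior,λ*[F]`),
then `λ*` is the unique global minimizer of `Hd`. -/
theorem stmt_11 {X : Type*} [MeasurableSpace X] (μ : Measure X) [SigmaFinite μ]
    (F : X → ℝ) (hF : Measurable F) (ℓ : X → ℝ) (hℓmeas : Measurable ℓ)
    (hℓnonneg : ∀ x, 0 ≤ ℓ x)
    (hint0 : ∀ l : ℝ, Integrable (fun x => Real.exp (-(l * F x))) μ)
    (hint1 : ∀ l : ℝ, Integrable (fun x => F x * Real.exp (-(l * F x))) μ)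
    (hint2 : ∀ l : ℝ, Integrable (fun x => F x ^ 2 * Real.exp (-(l * F x))) μ)
    (hint0ℓ : ∀ l : ℝ, Integrable (fun x => ℓ x * Real.exp (-(l * F x))) μ)
    (hint1ℓ : ∀ l : ℝ, Integrable (fun x => ℓ x * (F x * Real.exp (-(l * F x)))) μ)
    (hint2ℓ : ∀ l : ℝ, Integrable (fun x => ℓ x * (F x ^ 2 * Real.exp (-(l * F x)))) μ)
    (hZpos : ∀ l : ℝ, 0 < priorZ μ F l) (hZℓpos : ∀ l : ℝ, 0 < postZ μ ℓ F l)
    (hinfo : ∀ l : ℝ, postVar μ ℓ F l < priorVar μ F l)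
    (lstar : ℝ) (hroot : postMean μ ℓ F lstar = priorMean μ F lstar) :
    ∀ l : ℝ, l ≠ lstar →
      Real.log (priorZ μ F lstar) - Real.log (postZ μ ℓ F lstar)
        < Real.log (priorZ μ F l) - Real.log (postZ μ ℓ F l) := by
  have hZ (l : ℝ) : HasDerivAt (priorZ μ F) (-∫ x, F x * Real.exp (-(l * F x)) ∂μ) l := by
    simpa only [pow_zero, one_mul, zero_add, pow_one] using! hasDerivAt_integral_pow_mul_exp_neg hint0 0 l
  have hM (l : ℝ) : HasDerivAt (fun l : ℝ => ∫ x, F x * Real.exp (-(l * F x)) ∂μ)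
      (-∫ x, F x ^ 2 * Real.exp (-(l * F x)) ∂μ) l := by
    simpa using hasDerivAt_integral_pow_mul_exp_neg hint0 1 l
  have hZℓ (l : ℝ) : HasDerivAt (postZ μ ℓ F)
      (-∫ x, ℓ x * (F x * Real.exp (-(l * F x))) ∂μ) l := by
    simpa only [pow_zero, one_mul, zero_add, pow_one] using!
      hasDerivAt_integral_mul_pow_mul_exp_neg hℓmeas hℓnonneg hint0ℓ 0 l
  have hMℓ (l : ℝ) : HasDerivAt (fun l : ℝ => ∫ x, ℓ x * (F x * Real.exp (-(l * F x))) ∂μ)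
      (-∫ x, ℓ x * (F x ^ 2 * Real.exp (-(l * F x))) ∂μ) l := by
    simpa using hasDerivAt_integral_mul_pow_mul_exp_neg hℓmeas hℓnonneg hint0ℓ 1 l
  have hprior (l : ℝ) : HasDerivAt (priorMean μ F) (-priorVar μ F l) l :=
    hasDerivAt_one_div_mul (hZ l) (hM l) (hZpos l).ne'
  have hpost (l : ℝ) : HasDerivAt (postMean μ ℓ F) (-postVar μ ℓ F l) l :=
    hasDerivAt_one_div_mul (hZℓ l) (hMℓ l) (hZℓpos l).ne'
  have hmono : StrictMono fun l => postMean μ ℓ F l - priorMean μ F l := by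
    refine strictMono_of_deriv_pos fun l => ?_
    rw [((hpost l).fun_sub (hprior l)).deriv]
    linarith [hinfo l]
  have hH (l : ℝ) : HasDerivAt (fun l => Real.log (priorZ μ F l) - Real.log (postZ μ ℓ F l))
      (postMean μ ℓ F l - priorMean μ F l) l := by
    refine (((hZ l).log (hZpos l).ne').fun_sub ((hZℓ l).log (hZℓpos l).ne')).congr_deriv ?_
    simp only [postMean, priorMean]
    ring
  intro l hl
  exact lt_of_hasDerivAt_of_strictMono hH hmono (sub_eq_zero.2 hroot) hl
end
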